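/- Let C be a triangulated category equipped with a cotorsion pair (S,V) such that K := add(S*V) is functorially finite in C. Then the class R of regular morphisms of C/K (morphisms that are simultaneously a monomorphism and an epimorphism) admits a calculus of left fractions and a calculus of right fractions, and the Gabriel–Zisman localization (C/K)[R^{-1}] is an abelian category. -/

import Mathlib

universe w v u v₂ u₂

open CategoryTheory Category Limits Pretriangulated

namespace PaperFormalization

variable (C : Type u) [Category.{v} C] [Preadditive C] [HasZeroObject C]
  [HasShift C ℤ] [∀ n : ℤ, (shiftFunctor C n).Additive] [Pretriangulated C]
  [IsTriangulated C] [HasBinaryBiproducts C]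

/-- `X` is a direct summand of `Z`. -/
def IsSummandOf (X Z : C) : Prop := ∃ (i : X ⟶ Z) (p : Z ⟶ X), i ≫ p = 𝟙 X

/-- The morphism `f` factors through some object of `A`. -/
def FactorsThruSet (A : Set C) {X Y : C} (f : X ⟶ Y) : Prop :=
  ∃ Z ∈ A, ∃ (a : X ⟶ Z) (b : Z ⟶ Y), a ≫ b = f

/-- A cotorsion pair `(S, V)` supported on the (triangulated) subcategory determined by
`N ⊆ C`: both classes are contained in `N`, each is closed under isomorphisms, finite
direct sums and direct summands, `Hom(S, V⟦1⟧) = 0`, and every object of `N` admits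
distinguished triangles `V' → S' → X → V'⟦1⟧` and `X → V' → S' → X⟦1⟧` with `S' ∈ S`,
`V' ∈ V`. -/
structure IsTriCotorsionPairOn (N S V : Set C) : Prop where
  S_sub : S ⊆ N
  V_sub : V ⊆ N
  S_iso : ∀ {X Y : C}, (X ≅ Y) → X ∈ S → Y ∈ S
  S_sum : ∀ {X Y : C}, X ∈ S → Y ∈ S → (X ⊞ Y) ∈ S
  S_summand : ∀ {X Z : C}, Z ∈ S → IsSummandOf C X Z → X ∈ S
  V_iso : ∀ {X Y : C}, (X ≅ Y) → X ∈ V → Y ∈ V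
  V_sum : ∀ {X Y : C}, X ∈ V → Y ∈ V → (X ⊞ Y) ∈ V
  V_summand : ∀ {X Z : C}, Z ∈ V → IsSummandOf C X Z → X ∈ V
  orth : ∀ {A B : C}, A ∈ S → B ∈ V → ∀ f : A ⟶ (B⟦(1 : ℤ)⟧), f = 0
  resolve : ∀ X ∈ N, ∃ (Vx Sx : C), Vx ∈ V ∧ Sx ∈ S ∧
    ∃ (f : Vx ⟶ Sx) (g : Sx ⟶ X) (h : X ⟶ (Vx⟦(1 : ℤ)⟧)),
      Triangle.mk f g h ∈ distTriang C
  coresolve : ∀ X ∈ N, ∃ (Vx Sx : C), Vx ∈ V ∧ Sx ∈ S ∧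
    ∃ (f : X ⟶ Vx) (g : Vx ⟶ Sx) (h : Sx ⟶ (X⟦(1 : ℤ)⟧)),
      Triangle.mk f g h ∈ distTriang C

/-- A cotorsion pair `(S, V)` on the triangulated category `C` itself. -/
abbrev IsTriCotorsionPair (S V : Set C) : Prop := IsTriCotorsionPairOn C Set.univ S V

/-- The class `S * V` of objects `Y` admitting a distinguished triangle
`S → Y → V → S⟦1⟧` with `S ∈ S`, `V ∈ V`. -/
def SstarV (S V : Set C) : Set C :=
  {Y | ∃ (S' V' : C), S' ∈ S ∧ V' ∈ V ∧
    ∃ (f : S' ⟶ Y) (g : Y ⟶ V') (h : V' ⟶ (S'⟦(1 : ℤ)⟧)),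
      Triangle.mk f g h ∈ distTriang C}

/-- Membership in the additive closure of `A`: closure of `A` under isomorphisms,
finite direct sums and direct summands. -/
inductive addMem (A : Set C) : C → Prop
  | of {X : C} : X ∈ A → addMem A X
  | iso {X Y : C} : (X ≅ Y) → addMem A X → addMem A Y
  | sum {X Y : C} : addMem A X → addMem A Y → addMem A (X ⊞ Y)
  | summand {X Z : C} : addMem A Z → IsSummandOf C X Z → addMem A X

/-- `K := add (S * V)`. -/
def Kcl (S V : Set C) : Set C := {X | addMem C (SstarV C S V) X}

/-- `A` is functorially finite: every object has a left `A`-approximation and a right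
`A`-approximation. -/
def FunctoriallyFinite (A : Set C) : Prop :=
  (∀ X : C, ∃ K ∈ A, ∃ ι : X ⟶ K, ∀ K' ∈ A, ∀ f : X ⟶ K', ∃ t : K ⟶ K', ι ≫ t = f) ∧
  (∀ X : C, ∃ K ∈ A, ∃ p : K ⟶ X, ∀ K' ∈ A, ∀ f : K' ⟶ X, ∃ t : K' ⟶ K, t ≫ p = f)

/-- The ideal-quotient relation on `C` modulo morphisms factoring through `K`;
the corresponding quotient category is the additive quotient `C/K`. -/
def Krel (S V : Set C) : HomRel C :=
  fun {X Y} f g => FactorsThruSet C (Kcl C S V) (f - g)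

/-- The additive quotient `C/K`. -/
abbrev KQuot (S V : Set C) := CategoryTheory.Quotient (Krel C S V)

/-- The additive quotient functor `ϖ : C ⥤ C/K`. -/
abbrev Kproj (S V : Set C) : C ⥤ KQuot C S V :=
  CategoryTheory.Quotient.functor (Krel C S V)

/-- The class `R` of regular morphisms of `C/K`: those which are simultaneously a
monomorphism and an epimorphism. -/
def RegClass (S V : Set C) : MorphismProperty (KQuot C S V) := fun _ _ f => Mono f ∧ Epi f

set_option linter.unusedSectionVars false

section Triangles

variable {C} {X Y Z W : C} {f : X ⟶ Y} {g : Y ⟶ Z} {h : Z ⟶ X⟦(1 : ℤ)⟧}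
  (hT : Triangle.mk f g h ∈ distTriang C)

include hT

lemma exists_lift_shift_mor₁ (x : W ⟶ Y⟦(1 : ℤ)⟧) (hx : x ≫ g⟦(1 : ℤ)⟧' = 0) :
    ∃ w : W ⟶ X⟦(1 : ℤ)⟧, w ≫ f⟦(1 : ℤ)⟧' = x := by
  obtain ⟨w, hw⟩ : ∃ w : W ⟶ X⟦(1 : ℤ)⟧, x = w ≫ (-f⟦(1 : ℤ)⟧') :=
    Triangle.coyoneda_exact₁ _ (rot_of_distTriang _ hT) x hx
  exact ⟨-w, by simp [hw]⟩

lemma exists_lift_shift_mor₂ (x : W ⟶ Z⟦(1 : ℤ)⟧) (hx : x ≫ h⟦(1 : ℤ)⟧' = 0) :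
    ∃ w : W ⟶ Y⟦(1 : ℤ)⟧, w ≫ g⟦(1 : ℤ)⟧' = x := by
  obtain ⟨w, hw⟩ : ∃ w : W ⟶ Y⟦(1 : ℤ)⟧, x = w ≫ (-g⟦(1 : ℤ)⟧') :=
    Triangle.coyoneda_exact₁ _ (rot_of_distTriang _ (rot_of_distTriang _ hT)) x hx
  exact ⟨-w, by simp [hw]⟩

lemma exists_lift_mor₃ (x : W ⟶ X⟦(1 : ℤ)⟧) (hx : x ≫ f⟦(1 : ℤ)⟧' = 0) :
    ∃ w : W ⟶ Z, w ≫ h = x := by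
  obtain ⟨w, hw⟩ := Triangle.coyoneda_exact₁ _ hT x hx
  exact ⟨w, hw.symm⟩

lemma exists_lift_mor₂ (x : W ⟶ Z) (hx : x ≫ h = 0) : ∃ w : W ⟶ Y, w ≫ g = x := by
  obtain ⟨w, hw⟩ := Triangle.coyoneda_exact₃ _ hT x hx
  exact ⟨w, hw.symm⟩

lemma exists_lift_mor₁ (x : W ⟶ Y) (hx : x ≫ g = 0) : ∃ w : W ⟶ X, w ≫ f = x := by
  obtain ⟨w, hw⟩ := Triangle.coyoneda_exact₂ _ hT x hx
  exact ⟨w, hw.symm⟩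

lemma exists_desc_mor₁ (x : X ⟶ W) (hx : h ≫ x⟦(1 : ℤ)⟧' = 0) : ∃ w : Y ⟶ W, f ≫ w = x := by
  obtain ⟨w, hw⟩ : ∃ w : Y⟦(1 : ℤ)⟧ ⟶ W⟦(1 : ℤ)⟧, x⟦(1 : ℤ)⟧' = (-f⟦(1 : ℤ)⟧') ≫ w :=
    Triangle.yoneda_exact₃ _ (rot_of_distTriang _ hT) (x⟦(1 : ℤ)⟧') hx
  obtain ⟨w, rfl⟩ := (shiftFunctor C (1 : ℤ)).map_surjective w
  exact ⟨-w, (shiftFunctor C (1 : ℤ)).map_injective (by simp [hw])⟩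

lemma exists_desc_mor₂ (x : Y ⟶ W) (hx : f ≫ x = 0) : ∃ w : Z ⟶ W, g ≫ w = x := by
  obtain ⟨w, hw⟩ := Triangle.yoneda_exact₂ _ hT x hx
  exact ⟨w, hw.symm⟩

lemma exists_desc_mor₃ (x : Z ⟶ W⟦(1 : ℤ)⟧) (hx : g ≫ x = 0) :
    ∃ w : X ⟶ W, h ≫ w⟦(1 : ℤ)⟧' = x := by
  obtain ⟨w, hw⟩ : ∃ w : X⟦(1 : ℤ)⟧ ⟶ W⟦(1 : ℤ)⟧, x = h ≫ w := Triangle.yoneda_exact₃ _ hT x hx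
  obtain ⟨w, rfl⟩ := (shiftFunctor C (1 : ℤ)).map_surjective w
  exact ⟨w, hw.symm⟩

/-- The morphism of triangles induced by composing the second morphism with `q : Z ⟶ W⟦1⟧`. -/
lemma exists_hom_of_comp_mor₂ (q : Z ⟶ W⟦(1 : ℤ)⟧) {E : C} {j : W ⟶ E} {k : E ⟶ Y}
    (hE : Triangle.mk j k (g ≫ q) ∈ distTriang C) :
    ∃ φ : X ⟶ E, φ ≫ k = f ∧ h ≫ φ⟦(1 : ℤ)⟧' = q ≫ (-j⟦(1 : ℤ)⟧') := by
  obtain ⟨φ, h₁, h₂⟩ := complete_distinguished_triangle_morphism₁ _ _ hT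
    (rot_of_distTriang _ hE) (𝟙 Y) q (id_comp (g ≫ q)).symm
  exact ⟨φ, h₁.symm.trans (comp_id f), h₂⟩

/-- The morphism of triangles induced by precomposing the third morphism with `q : W ⟶ Z`. -/
lemma exists_hom_of_comp_mor₃ (q : W ⟶ Z) {E : C} {j : X ⟶ E} {k : E ⟶ W}
    (hE : Triangle.mk j k (q ≫ h) ∈ distTriang C) :
    ∃ φ : E ⟶ Y, j ≫ φ = f ∧ k ≫ q = φ ≫ g := by
  obtain ⟨φ, h₁, h₂⟩ := complete_distinguished_triangle_morphism₂ _ _ hE hT (𝟙 X) q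
    (by
      have : (q ≫ h) ≫ (𝟙 X)⟦(1 : ℤ)⟧' = q ≫ h := by simp
      exact this)
  exact ⟨φ, h₁.trans (id_comp f), h₂⟩

end Triangles

variable {C} in
/-- A morphism `f : X ⟶ Y` such that all composites `A⟦-1⟧ ⟶ X ⟶ Y ⟶ B⟦1⟧` with `A ∈ S` and
`B ∈ V` vanish; to avoid negative shifts, this is phrased after shifting once. -/
def IsNegligible (S V : Set C) {X Y : C} (f : X ⟶ Y) : Prop :=
  ∀ ⦃A B : C⦄, A ∈ S → B ∈ V → ∀ (s : A ⟶ X⟦(1 : ℤ)⟧) (v : Y ⟶ B⟦(1 : ℤ)⟧),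
    s ≫ f⟦(1 : ℤ)⟧' ≫ v⟦(1 : ℤ)⟧' = 0

namespace IsNegligible

variable {C} {S V : Set C} {X Y Z : C}

lemma comp_right {f : X ⟶ Y} (hf : IsNegligible S V f) (g : Y ⟶ Z) :
    IsNegligible S V (f ≫ g) := fun A B hA hB s v => by
  simpa using hf hA hB s (g ≫ v)

lemma comp_left {g : Y ⟶ Z} (hg : IsNegligible S V g) (f : X ⟶ Y) :
    IsNegligible S V (f ≫ g) := fun A B hA hB s v => by
  simpa using hg hA hB (s ≫ f⟦(1 : ℤ)⟧') v

lemma add {f g : X ⟶ Y} (hf : IsNegligible S V f) (hg : IsNegligible S V g) :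
    IsNegligible S V (f + g) := fun A B hA hB s v => by
  simp [hf hA hB s v, hg hA hB s v]

lemma neg {f : X ⟶ Y} (hf : IsNegligible S V f) :
    IsNegligible S V (-f) := fun A B hA hB s v => by
  simp [hf hA hB s v]

lemma zero : IsNegligible S V (0 : X ⟶ Y) := fun A B hA hB s v => by simp

end IsNegligible

namespace IsTriCotorsionPairOn

variable {C} {S V : Set C} (hP : IsTriCotorsionPair C S V)

include hP

lemma isNegligible_id_of_mem {K : C} (hK : K ∈ Kcl C S V) : IsNegligible S V (𝟙 K) := by
  induction hK with
  | @of Y hY =>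
    obtain ⟨S', V', hS', hV', f, g, h, hT⟩ := hY
    intro A B hA hB s v
    obtain ⟨v, rfl⟩ := exists_desc_mor₂ hT v (hP.orth hS' hB _)
    simpa using (reassoc_of% (hP.orth hA hV' (s ≫ g⟦(1 : ℤ)⟧'))) (v⟦(1 : ℤ)⟧')
  | iso e _ ih => simpa using (ih.comp_left e.inv).comp_right e.hom
  | sum _ _ ihX ihY =>
    simpa using ((ihX.comp_left biprod.fst).comp_right biprod.inl).add
      ((ihY.comp_left biprod.snd).comp_right biprod.inr)
  | summand _ hi ih =>
    obtain ⟨i, p, hip⟩ := hi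
    simpa [hip] using (ih.comp_left i).comp_right p

/-- The morphisms factoring through `K` are exactly the negligible ones. -/
lemma factorsThruSet_iff {X Y : C} (f : X ⟶ Y) :
    FactorsThruSet C (Kcl C S V) f ↔ IsNegligible S V f := by
  constructor
  · rintro ⟨K, hK, a, b, rfl⟩
    simpa using ((hP.isNegligible_id_of_mem hK).comp_left a).comp_right b
  · intro hf
    obtain ⟨V₀, S₀, hV₀, hS₀, a, b, c, hX⟩ := hP.coresolve X trivial
    obtain ⟨V₁, S₁, hV₁, hS₁, p, r, y, hY⟩ := hP.resolve Y trivial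
    obtain ⟨σ, hσ⟩ := exists_lift_shift_mor₂ hY (c ≫ f⟦(1 : ℤ)⟧')
      (by simpa using hf hS₀ hV₁ c y)
    obtain ⟨E, i, q, hE⟩ := distinguished_cocone_triangle₂ (b ≫ σ)
    have hbc : b ≫ c = 0 := comp_distTriang_mor_zero₂₃ _ hX
    obtain ⟨ρ, hρ⟩ := exists_desc_mor₁ hE r (by rw [assoc, hσ, reassoc_of% hbc, zero_comp])
    obtain ⟨a', ha', hc⟩ := exists_hom_of_comp_mor₂ hX σ hE
    obtain ⟨τ, hτ⟩ := exists_desc_mor₁ hX (f + a' ≫ ρ) (by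
      rw [Functor.map_add, Functor.map_comp, Preadditive.comp_add, reassoc_of% hc, ← hσ, ← hρ]
      simp)
    exact ⟨E, .of ⟨S₁, V₀, hS₁, hV₀, i, q, _, hE⟩, a', q ≫ τ - ρ, by
      rw [Preadditive.comp_sub, reassoc_of% ha', hτ, add_sub_cancel_right]⟩

section

variable {X Y Z W : C} {f : X ⟶ Y} {g : Y ⟶ Z} {δ : Z ⟶ X⟦(1 : ℤ)⟧}
  (hT : Triangle.mk f g δ ∈ distTriang C)

include hT

/-- If the connecting morphism `Z⟦-1⟧ ⟶ X` of a distinguished triangle `X ⟶ Y ⟶ Z` is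
negligible, then `f : X ⟶ Y` is left cancellable modulo negligible morphisms. -/
lemma isNegligible_of_comp_mor₁
    (hδ : ∀ ⦃A B : C⦄, A ∈ S → B ∈ V → ∀ (s : A ⟶ Z) (v : X ⟶ B⟦(1 : ℤ)⟧),
      s ≫ δ ≫ v⟦(1 : ℤ)⟧' = 0)
    (w : W ⟶ X) (hw : IsNegligible S V (w ≫ f)) : IsNegligible S V w := by
  intro A B hA hB s v
  obtain ⟨V₁, S₁, hV₁, hS₁, p, ρ, y, hY⟩ := hP.resolve Y trivial
  obtain ⟨V₀, S₀, hV₀, hS₀, p₀, a, b, hZ⟩ := hP.resolve Z trivial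
  obtain ⟨Y', f', g', hY'⟩ := distinguished_cocone_triangle₂ (a ≫ δ)
  have hgδ : g ≫ δ = 0 := comp_distTriang_mor_zero₂₃ _ hT
  obtain ⟨φ, hφ₁, hφ₂⟩ := exists_hom_of_comp_mor₃ hT a hY'
  obtain ⟨v', hv'⟩ := exists_desc_mor₁ hY' v (by simpa using hδ hS₀ hB a v)
  obtain ⟨σ, hσ⟩ := exists_lift_shift_mor₂ hY (s ≫ w⟦(1 : ℤ)⟧' ≫ f⟦(1 : ℤ)⟧')
    (by simpa using hw hA hV₁ s y)
  obtain ⟨α, hα⟩ := exists_lift_mor₂ hZ (ρ ≫ g) (hP.orth hS₁ hV₀ _)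
  obtain ⟨β, hβ⟩ := exists_lift_mor₂ hY' α
    (by rw [← assoc, hα, assoc, hgδ, comp_zero])
  obtain ⟨γ, hγ⟩ := exists_lift_mor₁ hT (ρ - β ≫ φ)
    (by rw [Preadditive.sub_comp, assoc, ← hφ₂, reassoc_of% hβ, hα, sub_self])
  have hβ' : (β + γ ≫ f') ≫ φ = ρ := by rw [Preadditive.add_comp, assoc, hφ₁, hγ, add_sub_cancel]
  set β' := β + γ ≫ f'
  set D := s ≫ w⟦(1 : ℤ)⟧' ≫ f'⟦(1 : ℤ)⟧' - σ ≫ β'⟦(1 : ℤ)⟧' with hD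
  have hDφ : D ≫ φ⟦(1 : ℤ)⟧' = 0 := by
    simp only [hD, Preadditive.sub_comp, assoc, ← Functor.map_comp, hφ₁, hβ', hσ]
    simp
  obtain ⟨u, hu⟩ := exists_lift_shift_mor₁ hZ (D ≫ g'⟦(1 : ℤ)⟧')
    (by rw [assoc, ← Functor.map_comp, hφ₂, Functor.map_comp, reassoc_of% hDφ, zero_comp])
  obtain ⟨d, hd⟩ := exists_lift_shift_mor₁ hY' D
    (by rw [← hu, hP.orth hA hV₀ u, zero_comp])
  obtain ⟨e, rfl⟩ := exists_lift_mor₃ hT d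
    (by rw [← hφ₁, Functor.map_comp, reassoc_of% hd, hDφ])
  have h₁ : D ≫ v'⟦(1 : ℤ)⟧' = 0 := by
    rw [← hd, assoc, ← Functor.map_comp, hv', assoc, hδ hA hB]
  have h₂ : β' ≫ v' = 0 := hP.orth hS₁ hB _
  rw [hD, Preadditive.sub_comp, assoc, assoc, assoc, ← Functor.map_comp _ f' v', hv',
    ← Functor.map_comp _ β' v', h₂] at h₁
  simpa using h₁

/-- If `g` is negligible in a distinguished triangle `X ⟶ Y ⟶ Z`, then `f : X ⟶ Y` is
right cancellable modulo negligible morphisms. -/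
lemma isNegligible_of_mor₁_comp (hg : IsNegligible S V g)
    (w : Y ⟶ W) (hw : IsNegligible S V (f ≫ w)) : IsNegligible S V w := by
  intro A B hA hB s v
  obtain ⟨V₁, S₁, hV₁, hS₁, a, b, c, hX⟩ := hP.coresolve X trivial
  obtain ⟨V₀, S₀, hV₀, hS₀, p₀, r₀, q, hZ⟩ := hP.resolve Z trivial
  obtain ⟨Y', j, f', hY'⟩ := distinguished_cocone_triangle₂ (g ≫ q)
  have hgδ : g ≫ δ = 0 := comp_distTriang_mor_zero₂₃ _ hT
  obtain ⟨φ, hφ₁, hφ₂⟩ := exists_hom_of_comp_mor₂ hT q hY'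
  obtain ⟨s', hs'⟩ := exists_lift_shift_mor₂ hY' s (by simpa using hg hA hV₀ s q)
  obtain ⟨σ, hσ⟩ := exists_desc_mor₁ hX (f ≫ w ≫ v) (by simpa using hw hS₁ hB c v)
  obtain ⟨α, hα⟩ := exists_desc_mor₃ hZ (δ ≫ a⟦(1 : ℤ)⟧') (hP.orth hS₀ hV₁ _)
  obtain ⟨β, hβ⟩ := exists_desc_mor₁ hY' α
    (by rw [assoc, hα, reassoc_of% hgδ, zero_comp])
  obtain ⟨γ, hγ⟩ := exists_desc_mor₁ hT (a + φ ≫ β) (by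
    rw [Functor.map_add, Functor.map_comp, Preadditive.comp_add, reassoc_of% hφ₂, ← hα, ← hβ]
    simp)
  have hβ' : φ ≫ (f' ≫ γ - β) = a := by
    rw [Preadditive.comp_sub, reassoc_of% hφ₁, hγ, add_sub_cancel_right]
  set β' := f' ≫ γ - β
  set D := f' ≫ w ≫ v - β' ≫ σ with hD
  have hφD : φ ≫ D = 0 := by
    rw [hD, Preadditive.comp_sub, reassoc_of% hφ₁, reassoc_of% hβ', hσ, sub_self]
  obtain ⟨u, hu⟩ := exists_desc_mor₁ hZ (j ≫ D) (by
    have := hφ₂ =≫ D⟦(1 : ℤ)⟧'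
    rw [assoc, ← Functor.map_comp, hφD] at this
    simpa using this)
  obtain ⟨d, hd⟩ := exists_desc_mor₂ hY' D (by rw [← hu, hP.orth hS₀ hB u, comp_zero])
  obtain ⟨e, rfl⟩ := exists_desc_mor₂ hT d (by rw [← hφ₁, assoc, hd, hφD])
  have h₁ : s' ≫ D⟦(1 : ℤ)⟧' = 0 := by
    rw [← hd, Functor.map_comp, reassoc_of% hs', Functor.map_comp, hg hA hB]
  have h₂ : s' ≫ β'⟦(1 : ℤ)⟧' = 0 := hP.orth hA hV₁ _
  rw [hD, Functor.map_sub, Preadditive.comp_sub, Functor.map_comp, Functor.map_comp, Functor.map_comp,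
    reassoc_of% h₂, reassoc_of% hs', zero_comp, sub_zero] at h₁
  exact h₁

end

end IsTriCotorsionPairOn

/-- The regular morphisms of a category: those which are both mono and epi. -/
def regularMorphisms (A : Type*) [Category A] : MorphismProperty A := fun _ _ f => Mono f ∧ Epi f

instance (A : Type*) [Category A] : (regularMorphisms A).IsMultiplicative where
  id_mem _ := ⟨inferInstance, inferInstance⟩
  comp_mem _ _ hf hg :=
    have := hf.1
    have := hf.2
    have := hg.1
    have := hg.2
    ⟨mono_comp _ _, epi_comp _ _⟩

/-- Every span with one leg a monomorphism completes to a commutative square whose opposite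
edge is a monomorphism, and dually for cospans and epimorphisms. In the presence of pushouts and
pullbacks, this says that monomorphisms are stable under pushouts and epimorphisms are stable
under pullbacks. -/
class IsIntegralCategory (A : Type*) [Category A] : Prop where
  exists_mono {X Y W : A} (i : X ⟶ Y) (u : X ⟶ W) [Mono i] :
    ∃ (W' : A) (j : W ⟶ W') (v : Y ⟶ W'), Mono j ∧ i ≫ v = u ≫ j
  exists_epi {X Y W : A} (p : X ⟶ Y) (u : W ⟶ Y) [Epi p] :
    ∃ (W' : A) (q : W' ⟶ W) (v : W' ⟶ X), Epi q ∧ v ≫ p = q ≫ u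

namespace IsIntegralCategory

variable {A : Type*} [Category A] [IsIntegralCategory A]

lemma mono_pushout_inr {X Y W : A} (i : X ⟶ Y) (u : X ⟶ W) [Mono i] [HasPushout i u] :
    Mono (pushout.inr i u) := by
  obtain ⟨W', j, v, hj, fac⟩ := exists_mono i u
  have : Mono (pushout.inr i u ≫ pushout.desc v j fac) := by rwa [pushout.inr_desc]
  exact mono_of_mono _ (pushout.desc v j fac)

lemma epi_pullback_snd {X Y W : A} (p : X ⟶ Y) (u : W ⟶ Y) [Epi p] [HasPullback p u] :
    Epi (pullback.snd p u) := by
  obtain ⟨W', q, v, hq, fac⟩ := exists_epi p u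
  have : Epi (pullback.lift v q fac ≫ pullback.snd p u) := by rwa [pullback.lift_snd]
  exact epi_of_epi (pullback.lift v q fac) _

instance [HasPushouts A] : (regularMorphisms A).HasLeftCalculusOfFractions where
  exists_leftFraction _ _ φ := by
    have := φ.hs.1
    have := φ.hs.2
    exact ⟨⟨pushout.inl φ.s φ.f, pushout.inr φ.s φ.f, mono_pushout_inr _ _, inferInstance⟩,
      pushout.condition.symm⟩
  ext X' X Y f₁ f₂ s hs h := by
    have := hs.2
    exact ⟨Y, 𝟙 Y, (regularMorphisms A).id_mem Y, by rw [(cancel_epi s).1 h]⟩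

instance [HasPullbacks A] : (regularMorphisms A).HasRightCalculusOfFractions where
  exists_rightFraction _ _ φ := by
    have := φ.hs.1
    have := φ.hs.2
    exact ⟨⟨pullback.snd φ.s φ.f, ⟨inferInstance, epi_pullback_snd _ _⟩, pullback.fst φ.s φ.f⟩,
      pullback.condition.symm⟩
  ext X Y Y' f₁ f₂ s hs h := by
    have := hs.1
    exact ⟨X, 𝟙 X, (regularMorphisms A).id_mem X, by rw [(cancel_mono s).1 h]⟩

section Normal

variable [Preadditive A] [HasKernels A] [HasCokernels A] {X Y : A} (f : X ⟶ Y)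

/-- A monomorphism differs from the kernel of its cokernel by a regular morphism. -/
lemma regularMorphisms_kernel_lift [Mono f] :
    regularMorphisms A (kernel.lift (cokernel.π f) f (cokernel.condition f)) := by
  refine ⟨mono_of_mono_fac (kernel.lift_ι (cokernel.π f) f (cokernel.condition f)),
    Preadditive.epi_of_cancel_zero _ fun {R} u hu => ?_⟩
  obtain ⟨R', j, v, _, fac⟩ := exists_mono (kernel.ι (cokernel.π f)) u
  have hv : f ≫ v = 0 := by
    rw [← kernel.lift_ι (cokernel.π f) f (cokernel.condition f), assoc, fac, reassoc_of% hu,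
      zero_comp]
  rw [← cancel_mono j, zero_comp, ← fac, ← cokernel.π_desc f v hv, kernel.condition_assoc,
    zero_comp]

/-- An epimorphism differs from the cokernel of its kernel by a regular morphism. -/
lemma regularMorphisms_cokernel_desc [Epi f] :
    regularMorphisms A (cokernel.desc (kernel.ι f) f (kernel.condition f)) := by
  refine ⟨Preadditive.mono_of_cancel_zero _ fun {R} u hu => ?_,
    epi_of_epi_fac (cokernel.π_desc (kernel.ι f) f (kernel.condition f))⟩
  obtain ⟨R', q, v, _, fac⟩ := exists_epi (cokernel.π (kernel.ι f)) u
  have hv : v ≫ f = 0 := by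
    rw [← cokernel.π_desc (kernel.ι f) f (kernel.condition f), reassoc_of% fac, hu, comp_zero]
  rw [← cancel_epi q, comp_zero, ← fac, ← kernel.lift_ι f v hv, assoc, cokernel.condition,
    comp_zero]

end Normal

section Localization

variable {D : Type*} [Category D]

section

variable (L : A ⥤ D) [L.IsLocalization (regularMorphisms A)]

lemma faithful_of_isLocalization [HasPushouts A] : L.Faithful where
  map_injective {X Y f g} h := by
    obtain ⟨Z, s, hs, fac⟩ := (MorphismProperty.map_eq_iff_postcomp L (regularMorphisms A) f g).1 h
    have := hs.1
    exact (cancel_mono s).1 fac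

/-- A morphism into `L.obj Y` is, up to an isomorphism of its source, in the image of `L`. -/
lemma exists_iso_comp_eq_map [HasPullbacks A] {T : D} {Y : A} (t : T ⟶ L.obj Y) :
    ∃ (T' : A) (e : L.obj T' ≅ T) (g : T' ⟶ Y), e.hom ≫ t = L.map g := by
  have := Localization.essSurj L (regularMorphisms A)
  obtain ⟨φ, hφ⟩ := Localization.exists_rightFraction L (regularMorphisms A)
    ((L.objObjPreimageIso T).hom ≫ t)
  have := Localization.inverts L (regularMorphisms A) φ.s φ.hs
  exact ⟨φ.X', asIso (L.map φ.s) ≪≫ L.objObjPreimageIso T, φ.f, by simp [hφ]⟩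

/-- A morphism out of `L.obj X` is, up to an isomorphism of its target, in the image of `L`. -/
lemma exists_comp_iso_eq_map [HasPushouts A] {T : D} {X : A} (t : L.obj X ⟶ T) :
    ∃ (T' : A) (e : T ≅ L.obj T') (g : X ⟶ T'), t ≫ e.hom = L.map g := by
  have := Localization.essSurj L (regularMorphisms A)
  obtain ⟨φ, hφ⟩ := Localization.exists_leftFraction L (regularMorphisms A)
    (t ≫ (L.objObjPreimageIso T).inv)
  have := Localization.inverts L (regularMorphisms A) φ.s φ.hs
  exact ⟨φ.Y', (L.objObjPreimageIso T).symm ≪≫ asIso (L.map φ.s), φ.f, by simp [reassoc_of% hφ]⟩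

end

variable [Preadditive A] [HasPushouts A] [HasPullbacks A] [Preadditive D]

section

variable (L : A ⥤ D) [L.IsLocalization (regularMorphisms A)] [L.Additive]

lemma mono_map {X Y : A} (f : X ⟶ Y) [Mono f] : Mono (L.map f) := by
  have := faithful_of_isLocalization L
  refine Preadditive.mono_of_cancel_zero _ fun {T} t ht => ?_
  obtain ⟨T', e, g, hg⟩ := exists_iso_comp_eq_map L t
  have hgf : g ≫ f = 0 := L.map_injective (by rw [L.map_comp, ← hg, assoc, ht]; simp)
  rw [← cancel_epi e.hom, hg, zero_of_comp_mono f hgf]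
  simp

lemma epi_map {X Y : A} (f : X ⟶ Y) [Epi f] : Epi (L.map f) := by
  have := faithful_of_isLocalization L
  refine Preadditive.epi_of_cancel_zero _ fun {T} t ht => ?_
  obtain ⟨T', e, g, hg⟩ := exists_comp_iso_eq_map L t
  have hfg : f ≫ g = 0 := L.map_injective (by rw [L.map_comp, ← hg, reassoc_of% ht]; simp)
  rw [← cancel_mono e.hom, hg, zero_of_epi_comp f hfg]
  simp

lemma exists_lift_kernel {Y Z : A} (f : Y ⟶ Z) [HasKernel f] {T : D} (t : T ⟶ L.obj Y)
    (ht : t ≫ L.map f = 0) : ∃ l : T ⟶ L.obj (kernel f), l ≫ L.map (kernel.ι f) = t := by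
  have := faithful_of_isLocalization L
  obtain ⟨T', e, g, hg⟩ := exists_iso_comp_eq_map L t
  have hgf : g ≫ f = 0 := L.map_injective (by rw [L.map_comp, ← hg, assoc, ht]; simp)
  exact ⟨e.inv ≫ L.map (kernel.lift f g hgf), by
    rw [assoc, ← L.map_comp, kernel.lift_ι, ← hg, e.inv_hom_id_assoc]⟩

lemma exists_desc_cokernel {X Y : A} (f : X ⟶ Y) [HasCokernel f] {T : D} (t : L.obj Y ⟶ T)
    (ht : L.map f ≫ t = 0) : ∃ l : L.obj (cokernel f) ⟶ T, L.map (cokernel.π f) ≫ l = t := by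
  have := faithful_of_isLocalization L
  obtain ⟨T', e, g, hg⟩ := exists_comp_iso_eq_map L t
  have hfg : f ≫ g = 0 := L.map_injective (by rw [L.map_comp, ← hg, reassoc_of% ht]; simp)
  exact ⟨L.map (cokernel.desc f g hfg) ≫ e.inv, by
    rw [← assoc, ← L.map_comp, cokernel.π_desc, ← hg, assoc, e.hom_inv_id, comp_id]⟩

end

lemma hasKernels_of_isLocalization (L : A ⥤ D)
    [L.IsLocalization (regularMorphisms A)] [L.Additive] [HasKernels A] : HasKernels D where
  has_limit f := by
    obtain ⟨g, ⟨e⟩⟩ :=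
      (Localization.essSurj_mapArrow L (regularMorphisms A)).mem_essImage (Arrow.mk f)
    have := mono_map L (kernel.ι g.hom)
    have w : L.map (kernel.ι g.hom) ≫ L.map g.hom = 0 := by
      rw [← L.map_comp, kernel.condition, L.map_zero]
    have hl : HasLimit (parallelPair (L.map g.hom) 0) :=
      ⟨_, KernelFork.IsLimit.ofι' (L.map (kernel.ι g.hom)) w fun k hk =>
        ⟨_, (exists_lift_kernel L g.hom k hk).choose_spec⟩⟩
    exact hasLimit_of_iso (show parallelPair (L.map g.hom) 0 ≅ _ from
      parallelPair.ext (Arrow.leftFunc.mapIso e) (Arrow.rightFunc.mapIso e)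
        (Arrow.w e.hom).symm (zero_comp.trans comp_zero.symm))

lemma hasCokernels_of_isLocalization (L : A ⥤ D)
    [L.IsLocalization (regularMorphisms A)] [L.Additive] [HasCokernels A] : HasCokernels D where
  has_colimit f := by
    obtain ⟨g, ⟨e⟩⟩ :=
      (Localization.essSurj_mapArrow L (regularMorphisms A)).mem_essImage (Arrow.mk f)
    have := epi_map L (cokernel.π g.hom)
    have w : L.map g.hom ≫ L.map (cokernel.π g.hom) = 0 := by
      rw [← L.map_comp, cokernel.condition, L.map_zero]
    have hl : HasColimit (parallelPair (L.map g.hom) 0) :=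
      ⟨_, CokernelCofork.IsColimit.ofπ' (L.map (cokernel.π g.hom)) w fun k hk =>
        ⟨_, (exists_desc_cokernel L g.hom k hk).choose_spec⟩⟩
    exact hasColimit_of_iso (show _ ≅ parallelPair (L.map g.hom) 0 from
      parallelPair.ext (Arrow.leftFunc.mapIso e.symm) (Arrow.rightFunc.mapIso e.symm)
        (Arrow.w e.inv).symm (zero_comp.trans comp_zero.symm))

variable [HasKernels A] [HasCokernels A]

lemma isNormalMonoCategory_of_isLocalization (L : A ⥤ D)
    [L.IsLocalization (regularMorphisms A)] [L.Additive] : IsNormalMonoCategory D where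
  normalMonoOfMono f _ := by
    obtain ⟨g, ⟨e⟩⟩ :=
      (Localization.essSurj_mapArrow L (regularMorphisms A)).mem_essImage (Arrow.mk f)
    have := faithful_of_isLocalization L
    have hLg : Mono (L.map g.hom) :=
      ((MorphismProperty.monomorphisms D).arrow_mk_iso_iff e).2 (.infer_property f)
    have hg : Mono g.hom := L.mono_of_mono_map hLg
    let r := kernel.lift (cokernel.π g.hom) g.hom (cokernel.condition g.hom)
    have hr : IsIso (L.map r) :=
      Localization.inverts L (regularMorphisms A) r (regularMorphisms_kernel_lift g.hom)
    have w : L.map g.hom ≫ L.map (cokernel.π g.hom) = 0 := by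
      rw [← L.map_comp, cokernel.condition, L.map_zero]
    exact ⟨NormalMono.ofArrowIso
      { Z := L.obj (cokernel g.hom)
        g := L.map (cokernel.π g.hom)
        w := w
        isLimit := KernelFork.IsLimit.ofι' (L.map g.hom) w fun k hk =>
          ⟨(exists_lift_kernel L _ k hk).choose ≫ inv (L.map r), by
            have h : inv (L.map r) ≫ L.map g.hom = L.map (kernel.ι (cokernel.π g.hom)) := by
              rw [IsIso.inv_comp_eq, ← L.map_comp, kernel.lift_ι]
            rw [assoc, h, (exists_lift_kernel L _ k hk).choose_spec]⟩ } e⟩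

lemma isNormalEpiCategory_of_isLocalization (L : A ⥤ D)
    [L.IsLocalization (regularMorphisms A)] [L.Additive] : IsNormalEpiCategory D where
  normalEpiOfEpi f _ := by
    obtain ⟨g, ⟨e⟩⟩ :=
      (Localization.essSurj_mapArrow L (regularMorphisms A)).mem_essImage (Arrow.mk f)
    have := faithful_of_isLocalization L
    have hLg : Epi (L.map g.hom) :=
      ((MorphismProperty.epimorphisms D).arrow_mk_iso_iff e).2 (.infer_property f)
    have hg : Epi g.hom := L.epi_of_epi_map hLg
    let r := cokernel.desc (kernel.ι g.hom) g.hom (kernel.condition g.hom)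
    have hr : IsIso (L.map r) :=
      Localization.inverts L (regularMorphisms A) r (regularMorphisms_cokernel_desc g.hom)
    have w : L.map (kernel.ι g.hom) ≫ L.map g.hom = 0 := by
      rw [← L.map_comp, kernel.condition, L.map_zero]
    exact ⟨NormalEpi.ofArrowIso
      { W := L.obj (kernel g.hom)
        g := L.map (kernel.ι g.hom)
        w := w
        isColimit := CokernelCofork.IsColimit.ofπ' (L.map g.hom) w fun k hk =>
          ⟨inv (L.map r) ≫ (exists_desc_cokernel L _ k hk).choose, by
            have h : L.map g.hom ≫ inv (L.map r) = L.map (cokernel.π (kernel.ι g.hom)) := by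
              rw [IsIso.comp_inv_eq, ← L.map_comp, cokernel.π_desc]
            rw [reassoc_of% h, (exists_desc_cokernel L _ k hk).choose_spec]⟩ } e⟩

/-- The localization of an integral preadditive category with kernels and cokernels at its
regular morphisms is abelian. -/
lemma nonempty_abelian_of_isLocalization (L : A ⥤ D)
    [L.IsLocalization (regularMorphisms A)] [L.Additive] [HasFiniteProducts A] :
    Nonempty (Abelian D) := by
  have := Localization.essSurj L (regularMorphisms A)
  have := L.hasFiniteProducts_of_additive_of_essSurj
  have := hasKernels_of_isLocalization L
  have := hasCokernels_of_isLocalization L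
  have := isNormalMonoCategory_of_isLocalization L
  have := isNormalEpiCategory_of_isLocalization L
  exact ⟨{}⟩

end Localization

end IsIntegralCategory

namespace IsTriCotorsionPairOn

open scoped ZeroObject

variable {C} {S V : Set C} (hP : IsTriCotorsionPair C S V)

include hP

lemma zero_mem_left : (0 : C) ∈ S := by
  obtain ⟨_, S₀, _, hS₀, -⟩ := hP.resolve 0 trivial
  exact hP.S_summand hS₀ ⟨0, 0, (isZero_zero C).eq_of_src _ _⟩

lemma zero_mem_right : (0 : C) ∈ V := by
  obtain ⟨V₀, _, hV₀, _, -⟩ := hP.resolve 0 trivial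
  exact hP.V_summand hV₀ ⟨0, 0, (isZero_zero C).eq_of_src _ _⟩

lemma left_subset_Kcl : S ⊆ Kcl C S V := fun A hA =>
  .of ⟨A, 0, hA, hP.zero_mem_right, _, _, _, contractible_distinguished A⟩

lemma right_subset_Kcl : V ⊆ Kcl C S V := fun A hA =>
  .of ⟨0, A, hP.zero_mem_left, hA, _, _, _, contractible_distinguished₁ A⟩

lemma congruence_Krel : Congruence (Krel C S V) where
  equivalence :=
    { refl f := (hP.factorsThruSet_iff _).2 (by simpa using IsNegligible.zero)
      symm h := (hP.factorsThruSet_iff _).2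
        (by simpa using ((hP.factorsThruSet_iff _).1 h).neg)
      trans h h' := (hP.factorsThruSet_iff _).2
        (by simpa using ((hP.factorsThruSet_iff _).1 h).add ((hP.factorsThruSet_iff _).1 h')) }
  comp_left f _ _ h := (hP.factorsThruSet_iff _).2
    (by simpa using ((hP.factorsThruSet_iff _).1 h).comp_left f)
  comp_right f h := (hP.factorsThruSet_iff _).2
    (by simpa using ((hP.factorsThruSet_iff _).1 h).comp_right f)

lemma Krel_add ⦃X Y : C⦄ (f₁ f₂ g₁ g₂ : X ⟶ Y) (hf : Krel C S V f₁ f₂) (hg : Krel C S V g₁ g₂) :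
    Krel C S V (f₁ + g₁) (f₂ + g₂) :=
  (hP.factorsThruSet_iff _).2 (by
    simpa [add_sub_add_comm] using
      ((hP.factorsThruSet_iff _).1 hf).add ((hP.factorsThruSet_iff _).1 hg))

section

variable [Congruence (Krel C S V)] [Preadditive (KQuot C S V)] [(Kproj C S V).Additive]

lemma Kproj_map_eq_zero_iff {X Y : C} (f : X ⟶ Y) :
    (Kproj C S V).map f = 0 ↔ IsNegligible S V f := by
  rw [← Functor.map_zero, Quotient.functor_map_eq_iff, Krel, sub_zero, hP.factorsThruSet_iff]

section

variable {X Y Z : C} {f : X ⟶ Y} {g : Y ⟶ Z} {δ : Z ⟶ X⟦(1 : ℤ)⟧}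
  (hT : Triangle.mk f g δ ∈ distTriang C)

include hT

/-- A morphism becomes mono in `C/K` if and only if the connecting morphism `Z⟦-1⟧ ⟶ X` of its
triangle is negligible. -/
lemma mono_Kproj_map_iff : Mono ((Kproj C S V).map f) ↔
    ∀ ⦃A B : C⦄, A ∈ S → B ∈ V → ∀ (s : A ⟶ Z) (v : X ⟶ B⟦(1 : ℤ)⟧),
      s ≫ δ ≫ v⟦(1 : ℤ)⟧' = 0 := by
  refine ⟨fun _ A B hA hB s v => ?_, fun hδ => Preadditive.mono_of_cancel_zero _ ?_⟩
  · have hδf : δ ≫ f⟦(1 : ℤ)⟧' = 0 := comp_distTriang_mor_zero₃₁ _ hT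
    let e : A⟦(-1 : ℤ)⟧⟦(1 : ℤ)⟧ ≅ A := (shiftEquiv C (1 : ℤ)).counitIso.app A
    obtain ⟨w, hw⟩ := (shiftFunctor C (1 : ℤ)).map_surjective (e.hom ≫ s ≫ δ)
    have hwf : w ≫ f = 0 := (shiftFunctor C (1 : ℤ)).map_injective (by simp [hw, hδf])
    have hw' : (Kproj C S V).map w = 0 := by
      rw [← cancel_mono ((Kproj C S V).map f), ← Functor.map_comp, hwf, Functor.map_zero,
        zero_comp]
    simpa [hw] using (hP.Kproj_map_eq_zero_iff w).1 hw' hA hB e.inv v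
  · rintro ⟨W⟩ w hw
    obtain ⟨w, rfl⟩ := (Kproj C S V).map_surjective w
    rw [← Functor.map_comp, hP.Kproj_map_eq_zero_iff] at hw
    exact (hP.Kproj_map_eq_zero_iff w).2 (hP.isNegligible_of_comp_mor₁ hT hδ w hw)

/-- A morphism becomes epi in `C/K` if and only if the next morphism of its triangle is
negligible. -/
lemma epi_Kproj_map_iff : Epi ((Kproj C S V).map f) ↔ IsNegligible S V g := by
  refine ⟨fun _ => ?_, fun hg => Preadditive.epi_of_cancel_zero _ ?_⟩
  · have hfg : f ≫ g = 0 := comp_distTriang_mor_zero₁₂ _ hT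
    rw [← hP.Kproj_map_eq_zero_iff, ← cancel_epi ((Kproj C S V).map f), ← Functor.map_comp, hfg,
      Functor.map_zero, comp_zero]
  · rintro ⟨W⟩ w hw
    obtain ⟨w, rfl⟩ := (Kproj C S V).map_surjective w
    rw [← Functor.map_comp, hP.Kproj_map_eq_zero_iff] at hw
    exact (hP.Kproj_map_eq_zero_iff w).2 (hP.isNegligible_of_mor₁_comp hT hg w hw)

end

lemma hasKernel_Kproj_map {X Y K : C} (f : X ⟶ Y) (hK : K ∈ Kcl C S V) (p : K ⟶ Y)
    (hp : ∀ K' ∈ Kcl C S V, ∀ t : K' ⟶ Y, ∃ t' : K' ⟶ K, t' ≫ p = t) :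
    HasKernel ((Kproj C S V).map f) := by
  obtain ⟨A, m, δ, hT⟩ := distinguished_cocone_triangle₁ (biprod.desc f p)
  have hK' := hP.isNegligible_id_of_mem hK
  have hpδ : p ≫ δ = 0 := by
    have h : biprod.desc f p ≫ δ = 0 := comp_distTriang_mor_zero₂₃ _ hT
    rw [← biprod.inr_desc f p, assoc, h, comp_zero]
  have hm : IsNegligible S V (m ≫ biprod.fst ≫ f) := by
    have h : m ≫ biprod.desc f p = 0 := comp_distTriang_mor_zero₁₂ _ hT
    rw [biprod.desc_eq, Preadditive.comp_add] at h
    rw [eq_neg_of_add_eq_zero_left h]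
    simpa using ((hK'.comp_right p).comp_left (m ≫ biprod.snd)).neg
  have : Mono ((Kproj C S V).map m) := (hP.mono_Kproj_map_iff hT).2 fun A B hA hB s v => by
    obtain ⟨t, rfl⟩ := hp A (hP.left_subset_Kcl hA) s
    rw [assoc, reassoc_of% hpδ, zero_comp, comp_zero]
  have : Mono ((Kproj C S V).map (m ≫ biprod.fst)) := Preadditive.mono_of_cancel_zero _ (by
    rintro ⟨W⟩ w hw
    obtain ⟨w, rfl⟩ := (Kproj C S V).map_surjective w
    rw [← cancel_mono ((Kproj C S V).map m), zero_comp]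
    rw [← Functor.map_comp, hP.Kproj_map_eq_zero_iff] at hw ⊢
    have h : w ≫ m = (w ≫ m ≫ biprod.fst) ≫ biprod.inl +
        (w ≫ m ≫ biprod.snd) ≫ 𝟙 K ≫ biprod.inr := by
      simp [← Preadditive.comp_add, biprod.total]
    rw [h]
    exact (hw.comp_right _).add ((hK'.comp_right _).comp_left _))
  refine ⟨⟨⟨_, KernelFork.IsLimit.ofι' ((Kproj C S V).map (m ≫ biprod.fst)) ?_ ?_⟩⟩⟩
  · rwa [← Functor.map_comp, hP.Kproj_map_eq_zero_iff, assoc]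
  · rintro ⟨W⟩ k hk
    apply Classical.indefiniteDescription
    obtain ⟨k, rfl⟩ := (Kproj C S V).map_surjective k
    rw [← Functor.map_comp, hP.Kproj_map_eq_zero_iff, ← hP.factorsThruSet_iff] at hk
    obtain ⟨K', hK', a, b, hab⟩ := hk
    obtain ⟨t, rfl⟩ := hp K' hK' b
    obtain ⟨l, hl⟩ := exists_lift_mor₁ hT (biprod.lift k (-(a ≫ t))) (by simp [hab])
    exact ⟨(Kproj C S V).map l, by rw [← Functor.map_comp, reassoc_of% hl, biprod.lift_fst]⟩

lemma hasCokernel_Kproj_map {X Y K : C} (f : X ⟶ Y) (hK : K ∈ Kcl C S V) (p : X ⟶ K)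
    (hp : ∀ K' ∈ Kcl C S V, ∀ t : X ⟶ K', ∃ t' : K ⟶ K', p ≫ t' = t) :
    HasCokernel ((Kproj C S V).map f) := by
  obtain ⟨B, g, δ, hT⟩ := distinguished_cocone_triangle (biprod.lift f p)
  have hK' := hP.isNegligible_id_of_mem hK
  have hδp : δ ≫ p⟦(1 : ℤ)⟧' = 0 := by
    have h : δ ≫ (biprod.lift f p)⟦(1 : ℤ)⟧' = 0 := comp_distTriang_mor_zero₃₁ _ hT
    rw [← biprod.lift_snd f p, Functor.map_comp, reassoc_of% h, zero_comp]
  have hg : IsNegligible S V (f ≫ biprod.inl ≫ g) := by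
    have h : biprod.lift f p ≫ g = 0 := comp_distTriang_mor_zero₁₂ _ hT
    rw [biprod.lift_eq, Preadditive.add_comp, assoc, assoc] at h
    rw [eq_neg_of_add_eq_zero_left h]
    simpa using ((hK'.comp_right (biprod.inr ≫ g)).comp_left p).neg
  have : Epi ((Kproj C S V).map g) :=
    (hP.epi_Kproj_map_iff (rot_of_distTriang _ hT)).2 fun A B' hA hB' s v => by
      obtain ⟨v, rfl⟩ := (shiftFunctor C (1 : ℤ)).map_surjective v
      obtain ⟨t, rfl⟩ := hp B' (hP.right_subset_Kcl hB') v
      have h : δ ≫ (p ≫ t)⟦(1 : ℤ)⟧' = 0 := by rw [Functor.map_comp, reassoc_of% hδp, zero_comp]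
      exact (congrArg (s ≫ ·) ((Functor.map_comp _ _ _).symm.trans
        ((congrArg _ h).trans (Functor.map_zero _ _ _)))).trans comp_zero
  have : Epi ((Kproj C S V).map (biprod.inl ≫ g)) := Preadditive.epi_of_cancel_zero _ (by
    rintro ⟨W⟩ w hw
    obtain ⟨w, rfl⟩ := (Kproj C S V).map_surjective w
    rw [← cancel_epi ((Kproj C S V).map g), comp_zero]
    rw [← Functor.map_comp, hP.Kproj_map_eq_zero_iff] at hw ⊢
    have h : g ≫ w = biprod.fst ≫ (biprod.inl ≫ g) ≫ w +
        biprod.snd ≫ 𝟙 K ≫ biprod.inr ≫ g ≫ w := by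
      rw [id_comp, assoc, ← assoc, ← assoc biprod.snd, ← Preadditive.add_comp, biprod.total,
        id_comp]
    rw [h]
    exact (hw.comp_left _).add ((hK'.comp_right _).comp_left _))
  refine ⟨⟨⟨_, CokernelCofork.IsColimit.ofπ' ((Kproj C S V).map (biprod.inl ≫ g)) ?_ ?_⟩⟩⟩
  · rwa [← Functor.map_comp, hP.Kproj_map_eq_zero_iff]
  · rintro ⟨W⟩ k hk
    apply Classical.indefiniteDescription
    obtain ⟨k, rfl⟩ := (Kproj C S V).map_surjective k
    rw [← Functor.map_comp, hP.Kproj_map_eq_zero_iff, ← hP.factorsThruSet_iff] at hk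
    obtain ⟨K', hK', a, b, hab⟩ := hk
    obtain ⟨t, rfl⟩ := hp K' hK' a
    rw [assoc] at hab
    obtain ⟨l, hl⟩ := exists_desc_mor₂ hT (biprod.desc k (-(t ≫ b))) (by simp [hab])
    exact ⟨(Kproj C S V).map l, by rw [← Functor.map_comp, assoc, hl, biprod.inl_desc]⟩

lemma hasKernels_KQuot (hff : FunctoriallyFinite C (Kcl C S V)) : HasKernels (KQuot C S V) where
  has_limit {X Y} f := by
    obtain ⟨f, rfl⟩ := (Kproj C S V).map_surjective f
    obtain ⟨K, hK, p, hp⟩ := hff.2 Y.as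
    exact hP.hasKernel_Kproj_map f hK p hp

lemma hasCokernels_KQuot (hff : FunctoriallyFinite C (Kcl C S V)) :
    HasCokernels (KQuot C S V) where
  has_colimit {X Y} f := by
    obtain ⟨f, rfl⟩ := (Kproj C S V).map_surjective f
    obtain ⟨K, hK, p, hp⟩ := hff.1 X.as
    exact hP.hasCokernel_Kproj_map f hK p hp

lemma isIntegralCategory_KQuot : IsIntegralCategory (KQuot C S V) where
  exists_mono := by
    rintro ⟨X⟩ ⟨Y⟩ ⟨W⟩ i u hi
    obtain ⟨i, rfl⟩ := (Kproj C S V).map_surjective i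
    obtain ⟨u, rfl⟩ := (Kproj C S V).map_surjective u
    obtain ⟨Z, g, δ, hT⟩ := distinguished_cocone_triangle i
    obtain ⟨W', j, k, hT'⟩ := distinguished_cocone_triangle₂ (δ ≫ u⟦(1 : ℤ)⟧')
    obtain ⟨v, hv⟩ : ∃ v : Y ⟶ W', i ≫ v = u ≫ j := by
      obtain ⟨v, hv, -⟩ := complete_distinguished_triangle_morphism₂ _ _ hT hT' u (𝟙 Z)
        (id_comp (δ ≫ u⟦(1 : ℤ)⟧')).symm
      exact ⟨v, hv⟩
    refine ⟨_, (Kproj C S V).map j, (Kproj C S V).map v, ?_, ?_⟩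
    · rw [hP.mono_Kproj_map_iff hT] at hi
      exact (hP.mono_Kproj_map_iff hT').2 fun A B hA hB s t => by
        simpa using hi hA hB s (u ≫ t)
    · rw [← Functor.map_comp, hv, Functor.map_comp]
  exists_epi := by
    rintro ⟨X⟩ ⟨Y⟩ ⟨W⟩ p u hp
    obtain ⟨p, rfl⟩ := (Kproj C S V).map_surjective p
    obtain ⟨u, rfl⟩ := (Kproj C S V).map_surjective u
    obtain ⟨Z, g, δ, hT⟩ := distinguished_cocone_triangle p
    obtain ⟨W', q, k, hT'⟩ := distinguished_cocone_triangle₁ (u ≫ g)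
    obtain ⟨v, hv⟩ : ∃ v : W' ⟶ X, q ≫ u = v ≫ p := by
      obtain ⟨v, hv, -⟩ := complete_distinguished_triangle_morphism₁ _ _ hT' hT u (𝟙 Z)
        (comp_id (u ≫ g))
      exact ⟨v, hv⟩
    refine ⟨_, (Kproj C S V).map q, (Kproj C S V).map v, ?_, ?_⟩
    · rw [hP.epi_Kproj_map_iff hT] at hp
      exact (hP.epi_Kproj_map_iff hT').2 (hp.comp_left u)
    · rw [← Functor.map_comp, ← hv, Functor.map_comp]

end

end IsTriCotorsionPairOn

/-- If `K = add (S * V)` is functorially finite, then the class `R` of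
regular morphisms of `C/K` admits calculi of left and right fractions, and the
Gabriel–Zisman localization `(C/K)[R⁻¹]` is abelian. -/
theorem statement3 (S V : Set C) (hP : IsTriCotorsionPair C S V)
    (hff : FunctoriallyFinite C (Kcl C S V)) :
    (RegClass C S V).HasLeftCalculusOfFractions ∧
    (RegClass C S V).HasRightCalculusOfFractions ∧
    Nonempty (Abelian ((RegClass C S V).Localization)) := by
  have := hP.congruence_Krel
  let : Preadditive (KQuot C S V) := Quotient.preadditive _ hP.Krel_add
  have : (Kproj C S V).Additive := Quotient.functor_additive _ hP.Krel_add
  have := hP.hasKernels_KQuot hff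
  have := hP.hasCokernels_KQuot hff
  have := hP.isIntegralCategory_KQuot
  have : HasFiniteProducts C := hasFiniteProducts_of_has_binary_and_terminal
  have : HasFiniteProducts (KQuot C S V) :=
    Functor.hasFiniteProducts_of_additive_of_essSurj (Kproj C S V)
  have := HasFiniteBiproducts.of_hasFiniteProducts (C := KQuot C S V)
  have : HasEqualizers (KQuot C S V) := Preadditive.hasEqualizers_of_hasKernels
  have : HasCoequalizers (KQuot C S V) := Preadditive.hasCoequalizers_of_hasCokernels
  have : HasPullbacks (KQuot C S V) := hasPullbacks_of_hasBinaryProducts_of_hasEqualizers _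
  have : HasPushouts (KQuot C S V) := hasPushouts_of_hasBinaryCoproducts_of_hasCoequalizers _
  change (regularMorphisms (KQuot C S V)).HasLeftCalculusOfFractions ∧
    (regularMorphisms (KQuot C S V)).HasRightCalculusOfFractions ∧
    Nonempty (Abelian (regularMorphisms (KQuot C S V)).Localization)
  exact ⟨inferInstance, inferInstance,
    IsIntegralCategory.nonempty_abelian_of_isLocalization (regularMorphisms (KQuot C S V)).Q⟩

end PaperFormalization
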